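/- arXiv:1102.0439 — 2 statements merged into one kernel-verified Lean document; each statement's English description precedes it below -/
import Mathlib

section
/- For a tripartite pure state |Ψ⟩_ABC with PPT reduced state ρ_BC, the following are equivalent for ρ_AB: (a) it satisfies the majorization criterion (eigenvalues of ρ_A majorize those of ρ_AB and eigenvalues of ρ_B majorize those of ρ_AB); (b) the eigenvalue multisets of ρ_A and ρ_AB coincide. -/
open Matrix BigOperators
open scoped ComplexOrder

noncomputable section

/-- A density matrix: positive semidefinite with trace one. -/
def IsDensity {α : Type*} [Fintype α] (ρ : Matrix α α ℂ) : Prop :=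
  ρ.PosSemidef ∧ ρ.trace = 1

/-- Tensor (Kronecker) product of matrices on a product index type. -/
def tens {α β : Type*} (σ : Matrix α α ℂ) (τ : Matrix β β ℂ) :
    Matrix (α × β) (α × β) ℂ :=
  fun p q => σ p.1 q.1 * τ p.2 q.2

/-- Separability: a finite convex combination of product density matrices. -/
def SeparableState {α β : Type*} [Fintype α] [Fintype β]
    (ρ : Matrix (α × β) (α × β) ℂ) : Prop :=
  ∃ (k : ℕ) (p : Fin k → ℝ) (σ : Fin k → Matrix α α ℂ) (τ : Fin k → Matrix β β ℂ),
    (∀ i, 0 ≤ p i) ∧ ∑ i, p i = 1 ∧ (∀ i, IsDensity (σ i)) ∧ (∀ i, IsDensity (τ i)) ∧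
    ρ = ∑ i, (p i : ℂ) • tens (σ i) (τ i)

/-- Partial transpose with respect to the second system. -/
def ptransB {α β : Type*} (ρ : Matrix (α × β) (α × β) ℂ) :
    Matrix (α × β) (α × β) ℂ :=
  fun p q => ρ (p.1, q.2) (q.1, p.2)

/-- Partial trace over the second system. -/
def ptrB {α β : Type*} [Fintype β] (ρ : Matrix (α × β) (α × β) ℂ) : Matrix α α ℂ :=
  fun i k => ∑ j, ρ (i, j) (k, j)

/-- Partial trace over the first system. -/
def ptrA {α β : Type*} [Fintype α] (ρ : Matrix (α × β) (α × β) ℂ) : Matrix β β ℂ :=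
  fun j l => ∑ i, ρ (i, j) (i, l)

/-- Rank-one projection |ψ⟩⟨ψ| associated with a vector. -/
def projv {α : Type*} (ψ : α → ℂ) : Matrix α α ℂ :=
  fun x y => ψ x * (starRingEnd ℂ) (ψ y)

/-- Unit vector condition. -/
def UnitVec {α : Type*} [Fintype α] (ψ : α → ℂ) : Prop :=
  ∑ x, Complex.normSq (ψ x) = 1

/-- Two-party reduced state ρ_АБ of a tripartite pure state. -/
def rhoAB {α β γ : Type*} [Fintype γ] (ψ : α × β × γ → ℂ) :
    Matrix (α × β) (α × β) ℂ :=
  fun p q => ∑ c, ψ (p.1, p.2, c) * (starRingEnd ℂ) (ψ (q.1, q.2, c))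

def rhoBC {α β γ : Type*} [Fintype α] (ψ : α × β × γ → ℂ) :
    Matrix (β × γ) (β × γ) ℂ :=
  fun p q => ∑ a, ψ (a, p.1, p.2) * (starRingEnd ℂ) (ψ (a, q.1, q.2))

def rhoAC {α β γ : Type*} [Fintype β] (ψ : α × β × γ → ℂ) :
    Matrix (α × γ) (α × γ) ℂ :=
  fun p q => ∑ b, ψ (p.1, b, p.2) * (starRingEnd ℂ) (ψ (q.1, b, q.2))

def rhoA {α β γ : Type*} [Fintype β] [Fintype γ] (ψ : α × β × γ → ℂ) :
    Matrix α α ℂ :=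
  fun x y => ∑ b, ∑ c, ψ (x, b, c) * (starRingEnd ℂ) (ψ (y, b, c))

def rhoB {α β γ : Type*} [Fintype α] [Fintype γ] (ψ : α × β × γ → ℂ) :
    Matrix β β ℂ :=
  fun x y => ∑ a, ∑ c, ψ (a, x, c) * (starRingEnd ℂ) (ψ (a, y, c))

def rhoC {α β γ : Type*} [Fintype α] [Fintype β] (ψ : α × β × γ → ℂ) :
    Matrix γ γ ℂ :=
  fun x y => ∑ a, ∑ b, ψ (a, b, x) * (starRingEnd ℂ) (ψ (a, b, y))

/-- `x` majorizes `y` (for nonnegative vectors, with implicit zero padding):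
the sum of any `|T|` entries of `y` is dominated by some choice of at most
`|T|` entries of `x`, and the total sums agree. -/
def Majorizes {α β : Type*} [Fintype α] [Fintype β] (x : α → ℝ) (y : β → ℝ) : Prop :=
  (∀ T : Finset β, ∃ S : Finset α, S.card ≤ T.card ∧ ∑ i ∈ T, y i ≤ ∑ i ∈ S, x i) ∧
  ∑ i, x i = ∑ i, y i

/-- Von Neumann entropy of a Hermitian matrix, via its eigenvalues. -/
def vN {α : Type*} [Fintype α] [DecidableEq α] {ρ : Matrix α α ℂ}
    (h : ρ.IsHermitian) : ℝ :=
  -∑ i, h.eigenvalues i * Real.log (h.eigenvalues i)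

/-- Tensor rank of a tripartite vector: least number of product vectors summing to it. -/
def tensorRank {α β γ : Type*} [Fintype α] [Fintype β] [Fintype γ]
    (ψ : α × β × γ → ℂ) : ℕ :=
  sInf {r : ℕ | ∃ (a : Fin r → α → ℂ) (b : Fin r → β → ℂ) (c : Fin r → γ → ℂ),
    ∀ x, ψ x = ∑ i, a i x.1 * b i x.2.1 * c i x.2.2}

/-- Orthonormal family of vectors. -/
def OrthonormalFam {α : Type*} [Fintype α] {k : ℕ} (v : Fin k → α → ℂ) : Prop :=
  ∀ i j, ∑ x, (starRingEnd ℂ) (v i x) * v j x = if i = j then 1 else 0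

/-- Maximally correlated state: ρ = Σ_{i,j} c_{ij} |i_B⟩⟨j_B| ⊗ |i_C⟩⟨j_C|
for some orthonormal families. -/
def IsMaxCorrelated {β γ : Type*} [Fintype β] [Fintype γ]
    (ρ : Matrix (β × γ) (β × γ) ℂ) : Prop :=
  ∃ (k : ℕ) (c : Matrix (Fin k) (Fin k) ℂ) (e : Fin k → β → ℂ) (f : Fin k → γ → ℂ),
    OrthonormalFam e ∧ OrthonormalFam f ∧
    ∀ p q, ρ p q = ∑ i, ∑ j,
      c i j * (e i p.1 * (starRingEnd ℂ) (e j q.1)) * (f i p.2 * (starRingEnd ℂ) (f j q.2))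

namespace Majorizes

variable {α β γ : Type*} [Fintype α] [Fintype β] [Fintype γ]

theorem trans {x : α → ℝ} {y : β → ℝ} {z : γ → ℝ}
    (hxy : Majorizes x y) (hyz : Majorizes y z) : Majorizes x z := by
  refine ⟨fun T => ?_, hxy.2.trans hyz.2⟩
  obtain ⟨S, hS, hTS⟩ := hyz.1 T
  obtain ⟨R, hR, hSR⟩ := hxy.1 S
  exact ⟨R, hR.trans hS, hTS.trans hSR⟩

theorem sum_max_sub_le {x : α → ℝ} {y : β → ℝ} (h : Majorizes x y) {t : ℝ} (ht : 0 ≤ t) :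
    ∑ j, max (y j - t) 0 ≤ ∑ i, max (x i - t) 0 := by
  obtain ⟨S, hS, hTS⟩ := h.1 (Finset.univ.filter fun j => t < y j)
  have hcard : (S.card : ℝ) * t ≤ ((Finset.univ.filter fun j => t < y j).card : ℝ) * t := by
    gcongr
  calc ∑ j, max (y j - t) 0 = ∑ j ∈ Finset.univ.filter (fun j => t < y j), (y j - t) := by
        rw [Finset.sum_filter]
        refine Finset.sum_congr rfl fun j _ => ?_
        split_ifs with hj
        · exact max_eq_left (by linarith)
        · exact max_eq_right (by linarith)
    _ ≤ ∑ i ∈ S, (x i - t) := by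
        simp only [Finset.sum_sub_distrib, Finset.sum_const, nsmul_eq_mul]
        linarith
    _ ≤ ∑ i ∈ S, max (x i - t) 0 := Finset.sum_le_sum fun i _ => le_max_left _ _
    _ ≤ ∑ i, max (x i - t) 0 :=
        Finset.sum_le_sum_of_subset_of_nonneg (Finset.subset_univ _)
          fun i _ _ => le_max_right _ _

end Majorizes

/-- The second difference of `t ↦ max (u - t) 0` at `v` with step `h`. -/
theorem second_difference_max_sub {u v h : ℝ} (hh : 0 < h) (hu : u ≠ v → h ≤ |u - v|) :
    max (u - (v - h)) 0 - 2 * max (u - v) 0 + max (u - (v + h)) 0 = if u = v then h else 0 := by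
  split_ifs with huv
  · subst huv
    rw [max_eq_left (by linarith), max_eq_left (by linarith), max_eq_right (by linarith)]
    ring
  · rcases le_abs.1 (hu huv) with h1 | h1
    · rw [max_eq_left (by linarith), max_eq_left (by linarith), max_eq_left (by linarith)]
      ring
    · rw [max_eq_right (by linarith), max_eq_right (by linarith), max_eq_right (by linarith)]
      ring

theorem exists_pos_le_abs_sub {α : Type*} [Finite α] (x : α → ℝ) (v : ℝ) :
    ∃ h > 0, ∀ i, x i ≠ v → h ≤ |x i - v| := by
  have key : ∀ᶠ h in nhdsWithin (0 : ℝ) (Set.Ioi 0), ∀ i, x i ≠ v → h ≤ |x i - v| := by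
    refine Filter.eventually_all.2 fun i => ?_
    by_cases hi : x i = v
    · simp [hi]
    · filter_upwards [nhdsWithin_le_nhds (Iic_mem_nhds (abs_pos.2 (sub_ne_zero.2 hi)))]
        with h hh _ using hh
  obtain ⟨h, hh, hpos⟩ := (key.and self_mem_nhdsWithin).exists
  exact ⟨h, hpos, hh⟩

theorem count_mul_eq_second_difference {ι : Type*} [Fintype ι] (z : ι → ℝ) {v h : ℝ}
    (hpos : 0 < h) (hz : ∀ i, z i ≠ v → h ≤ |z i - v|) :
    ((Multiset.count v (Finset.univ.val.map z) : ℕ) : ℝ) * h =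
      ∑ i, max (z i - (v - h)) 0 - 2 * ∑ i, max (z i - v) 0 + ∑ i, max (z i - (v + h)) 0 := by
  rw [Finset.mul_sum, ← Finset.sum_sub_distrib, ← Finset.sum_add_distrib,
    Finset.sum_congr rfl fun i _ => second_difference_max_sub hpos (hz i),
    ← Finset.sum_filter, Finset.sum_const, nsmul_eq_mul, Multiset.count_map,
    ← Finset.filter_val, Finset.card_val]
  simp only [eq_comm]

theorem Majorizes.filter_ne_zero_eq {α β : Type*} [Fintype α] [Fintype β]
    {x : α → ℝ} {y : β → ℝ} (hx : ∀ i, 0 ≤ x i) (hy : ∀ j, 0 ≤ y j)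
    (hxy : Majorizes x y) (hyx : Majorizes y x) :
    Multiset.filter (fun u => u ≠ 0) (Finset.univ.val.map x) =
      Multiset.filter (fun u => u ≠ 0) (Finset.univ.val.map y) := by
  classical
  ext v
  by_cases hv : v = 0
  · simp [hv]
  rw [Multiset.count_filter_of_pos (p := fun u => u ≠ 0) hv,
    Multiset.count_filter_of_pos (p := fun u => u ≠ 0) hv]
  rcases lt_or_gt_of_ne hv with hv | hv
  · rw [Multiset.count_eq_zero_of_notMem, Multiset.count_eq_zero_of_notMem]
    · simp only [Multiset.mem_map, not_exists, not_and]
      exact fun j _ hj => absurd (hy j) (by linarith)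
    · simp only [Multiset.mem_map, not_exists, not_and]
      exact fun j _ hj => absurd (hx j) (by linarith)
  obtain ⟨h₁, h₁pos, h₁x⟩ := exists_pos_le_abs_sub x v
  obtain ⟨h₂, h₂pos, h₂y⟩ := exists_pos_le_abs_sub y v
  set h := min v (min h₁ h₂)
  have hpos : 0 < h := lt_min hv (lt_min h₁pos h₂pos)
  have hh₁ : h ≤ h₁ := (min_le_right _ _).trans (min_le_left _ _)
  have hh₂ : h ≤ h₂ := (min_le_right _ _).trans (min_le_right _ _)
  have hhv : h ≤ v := min_le_left _ _
  have key : ∀ t, 0 ≤ t → ∑ i, max (x i - t) 0 = ∑ j, max (y j - t) 0 := fun t ht =>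
    le_antisymm (hyx.sum_max_sub_le ht) (hxy.sum_max_sub_le ht)
  have hxc := count_mul_eq_second_difference x hpos fun i hi => hh₁.trans (h₁x i hi)
  have hyc := count_mul_eq_second_difference y hpos fun i hi => hh₂.trans (h₂y i hi)
  rw [key _ (by linarith), key _ hv.le, key _ (by linarith), ← hyc] at hxc
  exact_mod_cast mul_right_cancel₀ hpos.ne' hxc

theorem majorizes_of_filter_ne_zero_eq {α β : Type*} [Fintype α] [Fintype β]
    {x : α → ℝ} {y : β → ℝ}
    (h : Multiset.filter (fun u => u ≠ 0) (Finset.univ.val.map x) =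
      Multiset.filter (fun u => u ≠ 0) (Finset.univ.val.map y)) :
    Majorizes x y := by
  classical
  have hsum : ∀ s : Multiset ℝ, (s.filter fun u => u ≠ 0).sum = s.sum := fun s => by
    induction s using Multiset.induction_on with
    | empty => simp
    | cons a s ih => by_cases ha : a = 0 <;> simp_all
  refine ⟨fun T => ?_, ?_⟩
  · have hle : (T.val.map y).filter (fun u => u ≠ 0) ≤ Finset.univ.val.map x :=
      calc (T.val.map y).filter (fun u => u ≠ 0)
          ≤ (Finset.univ.val.map y).filter (fun u => u ≠ 0) :=
            Multiset.filter_le_filter _ (Multiset.map_le_map (Finset.val_le_iff.2 T.subset_univ))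
        _ = (Finset.univ.val.map x).filter (fun u => u ≠ 0) := h.symm
        _ ≤ _ := Multiset.filter_le _ _
    obtain ⟨s, hs, hsx⟩ : ∃ s ≤ (Finset.univ : Finset α).val,
        s.map x = (T.val.map y).filter (fun u => u ≠ 0) := by
      generalize (Finset.univ : Finset α).val = m at hle
      generalize (T.val.map y).filter (fun u => u ≠ 0) = w at hle
      induction m using Multiset.induction_on generalizing w with
      | empty => exact ⟨0, le_rfl, by simpa using (Multiset.le_zero.1 hle).symm⟩
      | cons a m ih =>
        rw [Multiset.map_cons] at hle
        by_cases ha : x a ∈ w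
        · obtain ⟨w', rfl⟩ := Multiset.exists_cons_of_mem ha
          obtain ⟨s, hs, rfl⟩ := ih _ ((Multiset.cons_le_cons_iff _).1 hle)
          exact ⟨a ::ₘ s, (Multiset.cons_le_cons_iff _).2 hs, by simp⟩
        · obtain ⟨s, hs, rfl⟩ := ih _ ((Multiset.le_cons_of_notMem ha).1 hle)
          exact ⟨s, hs.trans (Multiset.le_cons_self _ _), rfl⟩
    refine ⟨⟨s, Multiset.nodup_of_le hs Finset.univ.nodup⟩, ?_, le_of_eq ?_⟩
    · calc s.card = (s.map x).card := (Multiset.card_map _ _).symm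
        _ ≤ (T.val.map y).card := hsx ▸ Multiset.card_le_card (Multiset.filter_le _ _)
        _ = T.card := Multiset.card_map _ _
    · calc ∑ j ∈ T, y j = (s.map x).sum := by rw [hsx, hsum]; rfl
        _ = _ := rfl
  · calc ∑ i, x i = (Finset.univ.val.map x).sum := rfl
      _ = (Finset.univ.val.map y).sum := by rw [← hsum, h, hsum]
      _ = _ := rfl

theorem exists_threshold_finset {β : Type*} [Fintype β] (l : β → ℝ) (hl : ∀ b, 0 ≤ l b)
    (k : ℕ) (hk : k ≤ Fintype.card β) :
    ∃ (S : Finset β) (t : ℝ), S.card = k ∧ 0 ≤ t ∧ (∀ b ∈ S, t ≤ l b) ∧ ∀ b ∉ S, l b ≤ t := by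
  classical
  induction k with
  | zero =>
    exact ⟨∅, ∑ b, l b, rfl, Finset.sum_nonneg fun b _ => hl b, by simp,
      fun b _ => Finset.single_le_sum (fun b _ => hl b) (Finset.mem_univ b)⟩
  | succ k ih =>
    obtain ⟨S, t, hS, -, htS, htS'⟩ := ih (by omega)
    have hne : Sᶜ.Nonempty := by
      rw [← Finset.card_pos, Finset.card_compl]
      omega
    obtain ⟨b, hb, hmax⟩ := Finset.exists_max_image Sᶜ l hne
    rw [Finset.mem_compl] at hb
    refine ⟨insert b S, l b, by rw [Finset.card_insert_of_notMem hb, hS], hl b, ?_, ?_⟩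
    · intro c hc
      rcases Finset.mem_insert.1 hc with rfl | hc
      · exact le_rfl
      · exact (htS' b hb).trans (htS c hc)
    · intro c hc
      exact hmax c (Finset.mem_compl.2 fun h => hc (Finset.mem_insert_of_mem h))

/-- A fractional selection of total weight at most `k` is beaten by some `k`-element set. -/
theorem exists_finset_sum_mul_le {β : Type*} [Fintype β] (l m : β → ℝ) (hl : ∀ b, 0 ≤ l b)
    (hm0 : ∀ b, 0 ≤ m b) (hm1 : ∀ b, m b ≤ 1) (k : ℕ) (hmk : ∑ b, m b ≤ k) :
    ∃ S : Finset β, S.card ≤ k ∧ ∑ b, l b * m b ≤ ∑ b ∈ S, l b := by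
  classical
  rcases le_total k (Fintype.card β) with hk | hk
  · obtain ⟨S, t, hS, ht, htS, htS'⟩ := exists_threshold_finset l hl k hk
    refine ⟨S, hS.le, ?_⟩
    have hpt : ∀ b, l b * m b ≤ (if b ∈ S then l b else 0) + t * (m b - if b ∈ S then 1 else 0) := by
      intro b
      split_ifs with hb
      · nlinarith [htS b hb, hm1 b]
      · nlinarith [htS' b hb, hm0 b]
    refine (Finset.sum_le_sum fun b _ => hpt b).trans ?_
    rw [Finset.sum_add_distrib, ← Finset.mul_sum, Finset.sum_sub_distrib]
    simp only [Finset.sum_ite_mem, Finset.univ_inter, Finset.sum_const, nsmul_eq_mul, mul_one, hS]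
    nlinarith
  · exact ⟨Finset.univ, hk, Finset.sum_le_sum fun b _ => by nlinarith [hl b, hm1 b]⟩

open Kronecker

section TripartiteMatrix

variable {α β γ : Type*}

/-- A tripartite vector viewed as a matrix from the first system to the other two. -/
def matBCA (ψ : α × β × γ → ℂ) : Matrix (β × γ) α ℂ := fun p a => ψ (a, p)

theorem rhoBC_eq [Fintype α] (ψ : α × β × γ → ℂ) : rhoBC ψ = matBCA ψ * (matBCA ψ)ᴴ := rfl

theorem rhoA_eq [Fintype β] [Fintype γ] (ψ : α × β × γ → ℂ) :
    rhoA ψ = ((matBCA ψ)ᴴ * matBCA ψ)ᵀ := by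
  ext x y
  simp [rhoA, matBCA, Matrix.mul_apply, Fintype.sum_prod_type, mul_comm]

theorem rhoB_eq [Fintype α] [Fintype γ] (ψ : α × β × γ → ℂ) : rhoB ψ = ptrB (rhoBC ψ) := by
  ext x y
  exact Finset.sum_comm

end TripartiteMatrix

section Reduction

variable {α β γ : Type*} [Fintype α] [Fintype β] [Fintype γ]

/-- Positivity of the partial transpose implies the reduction criterion. -/
theorem reduction_of_ppt [DecidableEq β] [DecidableEq γ]
    (ρ : Matrix (β × γ) (β × γ) ℂ) (h : (ptransB ρ).PosSemidef) :
    (ptrB ρ ⊗ₖ (1 : Matrix γ γ ℂ) - ρ).PosSemidef := by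
  let W : γ → γ → Matrix (β × γ) (β × γ) ℂ := fun i j =>
    (1 : Matrix β β ℂ) ⊗ₖ (Matrix.single j i 1 - Matrix.single i j 1)
  have hsum : ∑ i, ∑ j, (W i j)ᴴ * ptransB ρ * W i j =
      (2 : ℂ) • (ptrB ρ ⊗ₖ (1 : Matrix γ γ ℂ) - ρ) := by
    have entry : ∀ (E : Matrix γ γ ℂ) b c b' c',
        (((1 : Matrix β β ℂ) ⊗ₖ E)ᴴ * ptransB ρ * ((1 : Matrix β β ℂ) ⊗ₖ E)) (b, c) (b', c') =
        ∑ d', ∑ d, star (E d c) * ρ (b, d') (b', d) * E d' c' := by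
      intro E b c b' c'
      simp [Matrix.mul_apply, Fintype.sum_prod_type, Matrix.one_apply, ptransB, Finset.sum_mul,
        apply_ite, ite_mul]
    ext ⟨b, c⟩ ⟨b', c'⟩
    simp only [Matrix.sum_apply, W, entry]
    simp only [Matrix.sub_apply, Matrix.single_apply, star_sub, sub_mul, mul_sub,
      Finset.sum_sub_distrib, apply_ite star, star_one, star_zero, ite_and, ite_mul, mul_ite,
      mul_one, one_mul, mul_zero, zero_mul, Matrix.smul_apply, Matrix.kroneckerMap_apply, Matrix.one_apply,
      ptrB, smul_eq_mul]
    by_cases hc : c = c'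
    · subst hc
      simp
      ring
    · simp [hc, Ne.symm hc]
      ring
  have hpos : ((2 : ℂ) • (ptrB ρ ⊗ₖ (1 : Matrix γ γ ℂ) - ρ)).PosSemidef :=
    hsum ▸ Matrix.posSemidef_sum _ fun i _ => Matrix.posSemidef_sum _ fun j _ =>
      h.conjTranspose_mul_mul_same _
  have := hpos.smul (a := (2⁻¹ : ℂ)) (by positivity)
  rwa [smul_smul, inv_mul_cancel₀ two_ne_zero, one_smul] at this

theorem ptrB_conj_kronecker_one [DecidableEq γ] (U : Matrix β β ℂ) (X : Matrix (β × γ) (β × γ) ℂ) :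
    ptrB ((U ⊗ₖ (1 : Matrix γ γ ℂ))ᴴ * X * (U ⊗ₖ (1 : Matrix γ γ ℂ))) = Uᴴ * ptrB X * U := by
  ext b b'
  simp only [ptrB, Matrix.mul_apply, Fintype.sum_prod_type, Matrix.conjTranspose_apply,
    Matrix.kroneckerMap_apply, Matrix.one_apply, mul_ite, mul_one, mul_zero, apply_ite star,
    star_zero, ite_mul, zero_mul, Finset.sum_ite_eq', Finset.mem_univ, if_true,
    Finset.mul_sum, Finset.sum_mul]
  rw [Finset.sum_comm]
  refine Finset.sum_congr rfl fun d _ => ?_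
  rw [Finset.sum_comm]

theorem exists_finset_sum_le_of_reduction [DecidableEq β] [DecidableEq γ]
    (Φ : Matrix (β × γ) α ℂ) (l : β → ℝ) (m : α → ℝ)
    (hl : ∀ b, l b = ∑ c, ∑ a, Complex.normSq (Φ (b, c) a))
    (hm : ∀ a, m a = ∑ b, ∑ c, Complex.normSq (Φ (b, c) a))
    (hred : (Matrix.diagonal (fun b => (l b : ℂ)) ⊗ₖ (1 : Matrix γ γ ℂ) - Φ * Φᴴ).PosSemidef)
    (T : Finset α) : ∃ S : Finset β, S.card ≤ T.card ∧ ∑ a ∈ T, m a ≤ ∑ b ∈ S, l b := by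
  have hl0 : ∀ b, 0 ≤ l b := fun b => by
    rw [hl]
    exact Finset.sum_nonneg fun c _ => Finset.sum_nonneg fun a _ => Complex.normSq_nonneg _
  have hzero : ∀ b, l b = 0 → ∀ c a, Complex.normSq (Φ (b, c) a) = 0 := fun b hb c a => by
    rw [hl, Finset.sum_eq_zero_iff_of_nonneg fun c _ =>
      Finset.sum_nonneg fun a _ => Complex.normSq_nonneg _] at hb
    exact (Finset.sum_eq_zero_iff_of_nonneg fun a _ => Complex.normSq_nonneg _).1
      (hb c (Finset.mem_univ c)) a (Finset.mem_univ a)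
  have hquad : ∀ v : β × γ → ℂ, ∑ a, Complex.normSq (∑ p, star (Φ p a) * v p) ≤
      ∑ p, l p.1 * Complex.normSq (v p) := by
    intro v
    have h := hred.dotProduct_mulVec_nonneg v
    have h1 : star v ⬝ᵥ ((Φ * Φᴴ) *ᵥ v) =
        ((∑ a, Complex.normSq (∑ p, star (Φ p a) * v p) : ℝ) : ℂ) := by
      rw [← Matrix.mulVec_mulVec, Matrix.dotProduct_mulVec,
        show star v ᵥ* Φ = star (Φᴴ *ᵥ v) by rw [Matrix.star_mulVec, Matrix.conjTranspose_conjTranspose]]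
      simp [dotProduct, Matrix.mulVec, Complex.normSq_eq_conj_mul_self]
    have h2 : star v ⬝ᵥ ((Matrix.diagonal (fun b => (l b : ℂ)) ⊗ₖ (1 : Matrix γ γ ℂ)) *ᵥ v) =
        ((∑ p, l p.1 * Complex.normSq (v p) : ℝ) : ℂ) := by
      rw [← Matrix.diagonal_one, Matrix.diagonal_kronecker_diagonal]
      simp only [dotProduct, Matrix.mulVec_diagonal, Complex.ofReal_sum, Complex.ofReal_mul,
        Complex.normSq_eq_conj_mul_self, Pi.star_apply]
      exact Finset.sum_congr rfl fun p _ => by simp; ring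
    rw [Matrix.sub_mulVec, dotProduct_sub, h1, h2, sub_nonneg] at h
    exact_mod_cast h
  have hcol : ∀ a, ∑ b, ∑ c, Complex.normSq (Φ (b, c) a) / l b ≤ 1 := by
    intro a
    set s := ∑ b, ∑ c, Complex.normSq (Φ (b, c) a) / l b with hs
    have hs0 : 0 ≤ s := Finset.sum_nonneg fun b _ => Finset.sum_nonneg fun c _ =>
      div_nonneg (Complex.normSq_nonneg _) (hl0 b)
    have h := hquad fun p => Φ p a / l p.1
    have h1 : ∑ p : β × γ, star (Φ p a) * (Φ p a / l p.1) = (s : ℂ) := by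
      rw [hs, Fintype.sum_prod_type]
      push_cast
      refine Finset.sum_congr rfl fun b _ => Finset.sum_congr rfl fun c _ => ?_
      rw [Complex.normSq_eq_conj_mul_self, mul_div_assoc]
      rfl
    have h2 : ∑ p : β × γ, l p.1 * Complex.normSq (Φ p a / l p.1) = s := by
      rw [hs, Fintype.sum_prod_type]
      refine Finset.sum_congr rfl fun b _ => Finset.sum_congr rfl fun c _ => ?_
      rw [Complex.normSq_div, Complex.normSq_ofReal]
      rcases eq_or_ne (l b) 0 with hb | hb
      · simp [hb]
      · field_simp
    rw [h2] at h
    have h3 : s * s ≤ s := by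
      refine le_trans ?_ h
      refine le_trans (le_of_eq ?_) (Finset.single_le_sum
        (f := fun a' => Complex.normSq (∑ p : β × γ, star (Φ p a') * (Φ p a / l p.1)))
        (fun a' _ => Complex.normSq_nonneg _) (Finset.mem_univ a))
      simp only [h1, Complex.normSq_ofReal]
    nlinarith
  obtain ⟨S, hS, hTS⟩ := exists_finset_sum_mul_le l
    (fun b => ∑ a ∈ T, ∑ c, Complex.normSq (Φ (b, c) a) / l b) hl0
    (fun b => Finset.sum_nonneg fun a _ => Finset.sum_nonneg fun c _ =>
      div_nonneg (Complex.normSq_nonneg _) (hl0 b))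
    (fun b => by
      calc ∑ a ∈ T, ∑ c, Complex.normSq (Φ (b, c) a) / l b
          ≤ ∑ a, ∑ c, Complex.normSq (Φ (b, c) a) / l b :=
            Finset.sum_le_sum_of_subset_of_nonneg T.subset_univ fun a _ _ =>
              Finset.sum_nonneg fun c _ => div_nonneg (Complex.normSq_nonneg _) (hl0 b)
        _ = l b / l b := by
            rw [Finset.sum_comm]
            simp only [← Finset.sum_div]
            rw [← hl]
        _ ≤ 1 := div_self_le_one _)
    T.card (by
      rw [Finset.sum_comm]
      exact (Finset.sum_le_sum fun a _ => hcol a).trans (by simp))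
  refine ⟨S, hS, le_trans (le_of_eq ?_) hTS⟩
  simp only [hm, Finset.mul_sum]
  rw [Finset.sum_comm]
  refine Finset.sum_congr rfl fun b _ => Finset.sum_congr rfl fun a _ =>
    Finset.sum_congr rfl fun c _ => ?_
  rcases eq_or_ne (l b) 0 with hb | hb
  · simp [hb, hzero b hb]
  · field_simp

theorem conjTranspose_eigenvectorUnitary_mul_mul [DecidableEq α] {A : Matrix α α ℂ} (hA : A.IsHermitian) :
    (hA.eigenvectorUnitary : Matrix α α ℂ)ᴴ * A * (hA.eigenvectorUnitary : Matrix α α ℂ) =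
      Matrix.diagonal fun i => (hA.eigenvalues i : ℂ) := by
  have h := hA.conjStarAlgAut_star_eigenvectorUnitary
  rw [Unitary.conjStarAlgAut_star_apply] at h
  exact h

/-- The eigenvalues of `ρ_B` majorize those of `ρ_A` if `ρ_BC` has positive partial transpose. -/
theorem majorizes_rhoB_rhoA_of_ppt [DecidableEq α] [DecidableEq β] (ψ : α × β × γ → ℂ)
    (hppt : (ptransB (rhoBC ψ)).PosSemidef)
    (hA : (rhoA ψ).IsHermitian) (hB : (rhoB ψ).IsHermitian) :
    Majorizes hB.eigenvalues hA.eigenvalues := by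
  classical
  set U : Matrix β β ℂ := (hB.eigenvectorUnitary : Matrix β β ℂ)
  set V : Matrix α α ℂ := (hA.eigenvectorUnitary : Matrix α α ℂ)
  set Φ : Matrix (β × γ) α ℂ :=
    (U ⊗ₖ (1 : Matrix γ γ ℂ))ᴴ * matBCA ψ * V.map star
  have hU : U * Uᴴ = 1 := Unitary.coe_mul_star_self hB.eigenvectorUnitary
  have hV : V * Vᴴ = 1 := Unitary.coe_mul_star_self hA.eigenvectorUnitary
  have hV' : V.map star * (V.map star)ᴴ = 1 := by
    have h := congrArg (fun M : Matrix α α ℂ => M.map star) hV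
    ext i j
    simpa [Matrix.mul_apply, Matrix.one_apply, apply_ite] using congrFun (congrFun h i) j
  have hdB : Uᴴ * rhoB ψ * U = _ := conjTranspose_eigenvectorUnitary_mul_mul hB
  have hdA : Vᴴ * rhoA ψ * V = _ := conjTranspose_eigenvectorUnitary_mul_mul hA
  have hΦ : Φ * Φᴴ = (U ⊗ₖ (1 : Matrix γ γ ℂ))ᴴ * rhoBC ψ * (U ⊗ₖ (1 : Matrix γ γ ℂ)) := by
    rw [rhoBC_eq]
    calc Φ * Φᴴ = (U ⊗ₖ (1 : Matrix γ γ ℂ))ᴴ * matBCA ψ * (V.map star * (V.map star)ᴴ) *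
          (matBCA ψ)ᴴ * (U ⊗ₖ (1 : Matrix γ γ ℂ)) := by
          simp only [Φ, Matrix.conjTranspose_mul, Matrix.conjTranspose_conjTranspose,
            Matrix.mul_assoc]
      _ = _ := by rw [hV', Matrix.mul_one]; simp only [Matrix.mul_assoc]
  have hΦ' : (Φᴴ * Φ)ᵀ = Vᴴ * rhoA ψ * V := by
    have hUU : (U ⊗ₖ (1 : Matrix γ γ ℂ)) * (U ⊗ₖ (1 : Matrix γ γ ℂ))ᴴ = 1 := by
      rw [Matrix.conjTranspose_kronecker, ← Matrix.mul_kronecker_mul, hU]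
      simp
    have hVT : (V.map star)ᵀ = Vᴴ := rfl
    have hVT' : ((V.map star)ᴴ)ᵀ = V := by ext; simp
    calc (Φᴴ * Φ)ᵀ = ((V.map star)ᴴ * ((matBCA ψ)ᴴ * ((U ⊗ₖ (1 : Matrix γ γ ℂ)) *
          (U ⊗ₖ (1 : Matrix γ γ ℂ))ᴴ) * matBCA ψ) * V.map star)ᵀ := by
          simp only [Φ, Matrix.conjTranspose_mul, Matrix.conjTranspose_conjTranspose,
            Matrix.mul_assoc]
      _ = _ := by
          rw [hUU, Matrix.mul_one, Matrix.transpose_mul, Matrix.transpose_mul, hVT, hVT',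
            rhoA_eq, Matrix.mul_assoc]
  have hl : ∀ b, hB.eigenvalues b = ∑ c, ∑ a, Complex.normSq (Φ (b, c) a) := fun b => by
    have h := congrFun (congrFun hdB b) b
    have h' : Uᴴ * rhoB ψ * U = ptrB (Φ * Φᴴ) := by
      rw [hΦ, ptrB_conj_kronecker_one, rhoB_eq]
    rw [h', Matrix.diagonal_apply_eq] at h
    apply Complex.ofReal_injective
    rw [← h]
    simp [ptrB, Matrix.mul_apply, Complex.mul_conj]
  have hm : ∀ a, hA.eigenvalues a = ∑ b, ∑ c, Complex.normSq (Φ (b, c) a) := fun a => by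
    have h := congrFun (congrFun hdA a) a
    rw [← hΦ', Matrix.diagonal_apply_eq] at h
    apply Complex.ofReal_injective
    rw [← h]
    simp [Matrix.mul_apply, Fintype.sum_prod_type, Complex.normSq_eq_conj_mul_self]
  refine ⟨exists_finset_sum_le_of_reduction Φ _ _ hl hm ?_, ?_⟩
  · have h := (reduction_of_ppt _ hppt).conjTranspose_mul_mul_same (U ⊗ₖ (1 : Matrix γ γ ℂ))
    rw [Matrix.mul_sub, Matrix.sub_mul, ← hΦ, ← rhoB_eq, Matrix.conjTranspose_kronecker,
      ← Matrix.mul_kronecker_mul, ← Matrix.mul_kronecker_mul, hdB] at h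
    simpa using h
  · simp only [hl, hm]
    rw [Finset.sum_comm]
    simp only [Finset.sum_comm (s := (Finset.univ : Finset α))]
    rw [Finset.sum_comm]

end Reduction

theorem filter_ne_zero_eigenvalues_conjTranspose_mul_self {m n : Type*} [Fintype m] [Fintype n]
    [DecidableEq m] [DecidableEq n] (L : Matrix m n ℂ) {P : Matrix m m ℂ} {Q : Matrix n n ℂ}
    (hP : P.IsHermitian) (hQ : Q.IsHermitian) (hPL : P = L * Lᴴ) (hQL : Q = (Lᴴ * L)ᵀ) :
    Multiset.filter (fun u => u ≠ 0) (Finset.univ.val.map hP.eigenvalues) =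
      Multiset.filter (fun u => u ≠ 0) (Finset.univ.val.map hQ.eigenvalues) := by
  classical
  have h := Matrix.charpoly_mul_comm' L Lᴴ
  rw [← Matrix.charpoly_transpose (Lᴴ * L), ← hPL, ← hQL] at h
  have hr := congrArg Polynomial.roots h
  rw [Polynomial.roots_mul (mul_ne_zero (by simp) P.charpoly_monic.ne_zero),
    Polynomial.roots_mul (mul_ne_zero (by simp) Q.charpoly_monic.ne_zero),
    Polynomial.roots_X_pow, Polynomial.roots_X_pow,
    hP.roots_charpoly_eq_eigenvalues, hQ.roots_charpoly_eq_eigenvalues] at hr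
  ext v
  by_cases hv : v = 0
  · simp [hv]
  rw [Multiset.count_filter_of_pos (p := fun u => u ≠ 0) hv,
    Multiset.count_filter_of_pos (p := fun u => u ≠ 0) hv]
  have hc := congrArg (Multiset.count (v : ℂ)) hr
  have hv' : (v : ℂ) ∉ ({0} : Multiset ℂ) := by simpa using hv
  have hcount : ∀ s : Multiset ℝ, (s.map (fun u : ℝ => (u : ℂ))).count (v : ℂ) = s.count v :=
    fun s => Multiset.count_map_eq_count' _ _ Complex.ofReal_injective _
  simp only [Multiset.count_add, Multiset.count_nsmul, Multiset.count_eq_zero_of_notMem hv',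
    mul_zero, zero_add] at hc
  rw [← hcount, ← hcount, Multiset.map_map, Multiset.map_map]
  exact hc

/-- for a tripartite pure state with ρ_BC PPT, the majorization
criterion for ρ_AB is equivalent to the eigenvalue multisets of ρ_A and ρ_AB
coinciding (up to zeros). -/
theorem majorization_iff_equal_spectra_of_ppt_env {a b c : ℕ}
    (ψ : Fin a × Fin b × Fin c → ℂ) (hψ : UnitVec ψ)
    (hppt : (ptransB (rhoBC ψ)).PosSemidef)
    (hA : (rhoA ψ).IsHermitian) (hB : (rhoB ψ).IsHermitian)
    (hAB : (rhoAB ψ).IsHermitian) :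
    (Majorizes hA.eigenvalues hAB.eigenvalues ∧
     Majorizes hB.eigenvalues hAB.eigenvalues) ↔
    Multiset.filter (fun x => x ≠ 0) (Finset.univ.val.map hA.eigenvalues) =
      Multiset.filter (fun x => x ≠ 0) (Finset.univ.val.map hAB.eigenvalues) := by
  let L : Matrix (Fin a × Fin b) (Fin c) ℂ := fun p z => ψ (p.1, p.2, z)
  have hAB_eq : rhoAB ψ = L * Lᴴ := rfl
  have hC_eq : rhoC ψ = (Lᴴ * L)ᵀ := by
    ext x y
    change _ = ∑ p : Fin a × Fin b, star (L p y) * L p x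
    rw [Fintype.sum_prod_type]
    exact Finset.sum_congr rfl fun _ _ => Finset.sum_congr rfl fun _ _ => mul_comm _ _
  have hC : (rhoC ψ).IsHermitian :=
    hC_eq ▸ (Matrix.isHermitian_conjTranspose_mul_self L).transpose
  have hABC := filter_ne_zero_eigenvalues_conjTranspose_mul_self L hAB hC hAB_eq hC_eq
  have hBA := majorizes_rhoB_rhoA_of_ppt ψ hppt hA hB
  constructor
  · rintro ⟨hAAB, -⟩
    let φ : Fin a × Fin c × Fin b → ℂ := fun p => ψ (p.1, p.2.2, p.2.1)
    have hφA : rhoA φ = rhoA ψ := by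
      ext x y
      exact Finset.sum_comm
    have hφ : (ptransB (rhoBC φ)).PosSemidef := hppt.transpose.submatrix Prod.swap
    have hCA : Majorizes hC.eigenvalues hA.eigenvalues := by
      have h := majorizes_rhoB_rhoA_of_ppt φ hφ (hφA ▸ hA) hC
      have heq : ∀ {X Y : Matrix (Fin a) (Fin a) ℂ} (hX : X.IsHermitian) (hY : Y.IsHermitian),
          X = Y → hX.eigenvalues = hY.eigenvalues := by
        rintro X _ hX hY rfl
        rfl
      rwa [heq _ hA hφA] at h
    have hA0 : ∀ i, 0 ≤ hA.eigenvalues i := by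
      have h : (rhoA ψ).PosSemidef :=
        rhoA_eq ψ ▸ (Matrix.posSemidef_conjTranspose_mul_self _).transpose
      exact h.eigenvalues_nonneg
    have hAB0 : ∀ i, 0 ≤ hAB.eigenvalues i := by
      have h : (rhoAB ψ).PosSemidef := hAB_eq ▸ Matrix.posSemidef_self_mul_conjTranspose _
      exact h.eigenvalues_nonneg
    exact hAAB.filter_ne_zero_eq hA0 hAB0 ((majorizes_of_filter_ne_zero_eq hABC).trans hCA)
  · intro h
    have hAAB := majorizes_of_filter_ne_zero_eq h
    exact ⟨hAAB, hBA.trans hAAB⟩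

end
end

section
/- For density matrices ρ, σ on a finite-dimensional Hilbert space with supp(ρ) ⊆ supp(σ), and a partial trace (or more generally a quantum channel) Λ, the relative entropy is monotone: D(Λ(ρ) ‖ Λ(σ)) ≤ D(ρ ‖ σ), where D(ρ‖σ) = Tr(ρ log ρ − ρ log σ). In particular, for a bipartite state ρ_BC, D(ρ_BC ‖ I_B ⊗ ρ_C) = H(ρ_C) − H(ρ_BC) is monotone non-decreasing under extension to any state ρ_BCD with Tr_D ρ_BCD = ρ_BC. -/
open Matrix BigOperators
open scoped ComplexOrder

noncomputable section

/-- Logarithm of a Hermitian matrix via the spectral theorem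
(with the convention log 0 = 0 on the kernel). -/
def hermLog {α : Type*} [Fintype α] [DecidableEq α] {A : Matrix α α ℂ}
    (h : A.IsHermitian) : Matrix α α ℂ :=
  (h.eigenvectorUnitary : Matrix α α ℂ) *
    Matrix.diagonal (fun i => (Real.log (h.eigenvalues i) : ℂ)) *
    star (h.eigenvectorUnitary : Matrix α α ℂ)

/-- Quantum relative entropy D(ρ‖σ) = Tr(ρ (log ρ − log σ)). -/
def relEnt {α : Type*} [Fintype α] [DecidableEq α] {ρ σ : Matrix α α ℂ}
    (hρ : ρ.IsHermitian) (hσ : σ.IsHermitian) : ℝ :=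
  ((ρ * (hermLog hρ - hermLog hσ)).trace).re

/-- Partial trace over the third factor of a matrix indexed by β × (γ × δ). -/
def ptr3 {β γ δ : Type*} [Fintype δ]
    (τ : Matrix (β × γ × δ) (β × γ × δ) ℂ) : Matrix (β × γ) (β × γ) ℂ :=
  fun p q => ∑ d, τ (p.1, p.2, d) (q.1, q.2, d)

/-- Partial trace over the first factor of a matrix indexed by β × (γ × δ). -/
def ptr1 {β γ δ : Type*} [Fintype β]
    (τ : Matrix (β × γ × δ) (β × γ × δ) ℂ) : Matrix (γ × δ) (γ × δ) ℂ :=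
  fun p q => ∑ b, τ (b, p.1, p.2) (b, q.1, q.2)

/-- The quadratic functional of `X` whose maximum, integrated over `t`, recovers the quantum
relative entropy. -/
def relEntForm {n : Type*} [Fintype n] (t : ℝ) (ρ σ X : Matrix n n ℂ) : ℝ :=
  2 * (Xᴴ * ρ).trace.re - (Xᴴ * σ * X).trace.re - t * (X * ρ * Xᴴ).trace.re

section Diagonalization

variable {n : Type*} [Fintype n] [DecidableEq n]

theorem trace_conj_diagonal_mul_conj_diagonal (U W : Matrix n n ℂ) (a b : n → ℝ) :
    (W * diagonal (fun i => (a i : ℂ)) * Wᴴ *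
      (U * diagonal (fun j => (b j : ℂ)) * Uᴴ)).trace.re =
      ∑ i, ∑ j, Complex.normSq ((Uᴴ * W) j i) * a i * b j := by
  have h : (W * diagonal (fun i => (a i : ℂ)) * Wᴴ *
      (U * diagonal (fun j => (b j : ℂ)) * Uᴴ)).trace =
      (((Uᴴ * W) * diagonal (fun i => (a i : ℂ))) *
        ((Uᴴ * W)ᴴ * diagonal (fun j => (b j : ℂ)))).trace := by
    rw [← Matrix.mul_assoc _ _ Uᴴ, trace_mul_comm]
    simp only [conjTranspose_mul, conjTranspose_conjTranspose, Matrix.mul_assoc]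
  rw [h]
  generalize Uᴴ * W = M
  simp only [trace, diag_apply, mul_apply (M := M * _), mul_diagonal, conjTranspose_apply,
    Complex.re_sum]
  rw [Finset.sum_comm]
  refine Finset.sum_congr rfl fun i _ => Finset.sum_congr rfl fun j _ => ?_
  simp [Complex.normSq_apply]
  ring

theorem relEntForm_conj_diagonal {U W : Matrix n n ℂ} (hU : Uᴴ * U = 1) (hW : Wᴴ * W = 1)
    (p q : n → ℝ) (t : ℝ) (Z : Matrix n n ℂ) :
    relEntForm t (W * diagonal (fun i => (p i : ℂ)) * Wᴴ)
      (U * diagonal (fun j => (q j : ℂ)) * Uᴴ) (U * Z * Wᴴ) =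
      ∑ i, ∑ j, (2 * (star (Z j i) * (Uᴴ * W) j i).re * p i
        - (q j + t * p i) * Complex.normSq (Z j i)) := by
  have hcU : ∀ A : Matrix n n ℂ, Uᴴ * (U * A) = A := fun A => by
    rw [← Matrix.mul_assoc, hU, Matrix.one_mul]
  have hcW : ∀ A : Matrix n n ℂ, Wᴴ * (W * A) = A := fun A => by
    rw [← Matrix.mul_assoc, hW, Matrix.one_mul]
  have h₁ : ((U * Z * Wᴴ)ᴴ * (W * diagonal (fun i => (p i : ℂ)) * Wᴴ)).trace =
      (Zᴴ * ((Uᴴ * W) * diagonal (fun i => (p i : ℂ)))).trace := by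
    rw [← Matrix.mul_assoc, trace_mul_comm]
    simp only [conjTranspose_mul, conjTranspose_conjTranspose, Matrix.mul_assoc, hcW]
  have h₂ : ((U * Z * Wᴴ)ᴴ * (U * diagonal (fun j => (q j : ℂ)) * Uᴴ) * (U * Z * Wᴴ)).trace =
      (Zᴴ * diagonal (fun j => (q j : ℂ)) * Z).trace := by
    rw [← Matrix.mul_assoc, trace_mul_comm]
    simp only [conjTranspose_mul, conjTranspose_conjTranspose, Matrix.mul_assoc, hcW, hcU]
  have h₃ : (U * Z * Wᴴ * (W * diagonal (fun i => (p i : ℂ)) * Wᴴ) * (U * Z * Wᴴ)ᴴ).trace =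
      (Z * diagonal (fun i => (p i : ℂ)) * Zᴴ).trace := by
    simp only [conjTranspose_mul, conjTranspose_conjTranspose, Matrix.mul_assoc, hcW]
    rw [trace_mul_comm]
    simp only [Matrix.mul_assoc, hU, Matrix.mul_one]
  rw [relEntForm, h₁, h₂, h₃]
  generalize Uᴴ * W = M
  rw [Matrix.mul_assoc Zᴴ]
  simp only [trace, diag_apply, mul_apply (M := Zᴴ), mul_apply (M := Z * _), mul_diagonal,
    diagonal_mul, conjTranspose_apply, Complex.re_sum]
  rw [Finset.sum_comm (f := fun i j => (Z i j * _ * _).re)]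
  simp only [Finset.mul_sum, ← Finset.sum_sub_distrib]
  refine Finset.sum_congr rfl fun i _ => Finset.sum_congr rfl fun j _ => ?_
  simp [Complex.normSq_apply]
  ring

theorem two_mul_re_sub_le {a : ℝ} (ha : 0 < a) (p : ℝ) (z m : ℂ) :
    2 * (star z * m).re * p - a * Complex.normSq z ≤ Complex.normSq m * p ^ 2 / a := by
  rw [le_div_iff₀ ha]
  simp only [Complex.normSq_apply, Complex.mul_re, Complex.star_def, Complex.conj_re,
    Complex.conj_im]
  nlinarith [sq_nonneg (a * z.re - p * m.re), sq_nonneg (a * z.im - p * m.im)]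

theorem isGreatest_relEntForm {U W : Matrix n n ℂ} (hU : U ∈ unitaryGroup n ℂ)
    (hW : W ∈ unitaryGroup n ℂ) {p q : n → ℝ} (hp : ∀ i, 0 ≤ p i) (hq : ∀ j, 0 ≤ q j)
    {t : ℝ} (ht : 0 < t) :
    IsGreatest (Set.range (relEntForm t (W * diagonal (fun i => (p i : ℂ)) * Wᴴ)
      (U * diagonal (fun j => (q j : ℂ)) * Uᴴ)))
      (∑ i, ∑ j, Complex.normSq ((Uᴴ * W) j i) * p i ^ 2 / (q j + t * p i)) := by
  have hU₁ : Uᴴ * U = 1 := mem_unitaryGroup_iff'.1 hU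
  have hU₂ : U * Uᴴ = 1 := mem_unitaryGroup_iff.1 hU
  have hW₁ : Wᴴ * W = 1 := mem_unitaryGroup_iff'.1 hW
  have hW₂ : W * Wᴴ = 1 := mem_unitaryGroup_iff.1 hW
  constructor
  · refine ⟨U * of (fun j i => (Uᴴ * W) j i * ((p i / (q j + t * p i) : ℝ) : ℂ)) * Wᴴ, ?_⟩
    rw [relEntForm_conj_diagonal hU₁ hW₁]
    refine Finset.sum_congr rfl fun i _ => Finset.sum_congr rfl fun j _ => ?_
    rcases (hp i).eq_or_lt with h | h
    · simp [← h]
    · have h₀ : q j + t * p i ≠ 0 := (add_pos_of_nonneg_of_pos (hq j) (mul_pos ht h)).ne'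
      rw [of_apply]
      generalize (Uᴴ * W) j i = m
      generalize q j + t * p i = a at h₀ ⊢
      simp only [Complex.normSq_apply, Complex.mul_re, Complex.star_def,
        Complex.conj_re, Complex.conj_im, Complex.mul_im, Complex.ofReal_re, Complex.ofReal_im]
      field_simp
      ring
  · rintro _ ⟨X, rfl⟩
    have hX : X = U * (Uᴴ * X * W) * Wᴴ := by
      rw [← Matrix.mul_assoc, ← Matrix.mul_assoc, hU₂, Matrix.one_mul, Matrix.mul_assoc, hW₂,
        Matrix.mul_one]
    rw [hX, relEntForm_conj_diagonal hU₁ hW₁]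
    refine Finset.sum_le_sum fun i _ => Finset.sum_le_sum fun j _ => ?_
    rcases (hp i).eq_or_lt with h | h
    · simpa [← h] using mul_nonneg (hq j) (Complex.normSq_nonneg _)
    · exact two_mul_re_sub_le (add_pos_of_nonneg_of_pos (hq j) (mul_pos ht h)) _ _ _

end Diagonalization

section Primitive

variable {m n : Type*} [Fintype m] [Fintype n]

/-- The primitive in `t` of `∑ i j, w i j * p i ^ 2 / (q j + t * p i)` vanishing at zero. -/
def relEntPrimitive (w : n → n → ℝ) (p q : n → ℝ) (t : ℝ) : ℝ :=
  ∑ i, ∑ j, w i j * p i * (Real.log (q j + t * p i) - Real.log (q j))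

theorem relEntPrimitive_zero (w : n → n → ℝ) (p q : n → ℝ) : relEntPrimitive w p q 0 = 0 := by
  simp [relEntPrimitive]

theorem hasDerivAt_relEntPrimitive {w : n → n → ℝ} {p q : n → ℝ} (hp : ∀ i, 0 ≤ p i)
    (hq : ∀ j, 0 ≤ q j) {t : ℝ} (ht : 0 < t) :
    HasDerivAt (relEntPrimitive w p q) (∑ i, ∑ j, w i j * p i ^ 2 / (q j + t * p i)) t := by
  unfold relEntPrimitive
  refine HasDerivAt.fun_sum fun i _ => HasDerivAt.fun_sum fun j _ => ?_
  rcases (hp i).eq_or_lt with h | h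
  · simpa [← h] using hasDerivAt_const t (0 : ℝ)
  · have h₀ : q j + t * p i ≠ 0 := (add_pos_of_nonneg_of_pos (hq j) (mul_pos ht h)).ne'
    have h₁ : HasDerivAt (fun s => q j + s * p i) (p i) t := by
      simpa using ((hasDerivAt_id t).mul_const (p i)).const_add (q j)
    refine (((h₁.log h₀).sub_const (Real.log (q j))).const_mul (w i j * p i)).congr_deriv ?_
    ring

theorem continuousOn_relEntPrimitive {w : n → n → ℝ} {p q : n → ℝ} (hp : ∀ i, 0 ≤ p i)
    (hq : ∀ j, 0 ≤ q j) (hw : ∀ i j, q j = 0 → w i j * p i = 0) :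
    ContinuousOn (relEntPrimitive w p q) (Set.Ici 0) := by
  unfold relEntPrimitive
  refine continuousOn_finsetSum _ fun i _ => continuousOn_finsetSum _ fun j _ => ?_
  rcases (hq j).eq_or_lt with h | h
  · simpa [hw i j h.symm] using continuousOn_const
  · refine continuousOn_const.mul (ContinuousOn.sub (ContinuousOn.log (by fun_prop) ?_)
      continuousOn_const)
    intro t ht
    exact (add_pos_of_pos_of_nonneg h (mul_nonneg ht (hp i))).ne'

open Filter Topology in
theorem tendsto_relEntPrimitive_sub_log {w : n → n → ℝ} {p q : n → ℝ} (hp : ∀ i, 0 ≤ p i)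
    (hq : ∀ j, 0 ≤ q j) :
    Tendsto (fun t => relEntPrimitive w p q t - (∑ i, ∑ j, w i j * p i) * Real.log t) atTop
      (𝓝 (∑ i, ∑ j, w i j * p i * (Real.log (p i) - Real.log (q j)))) := by
  simp only [relEntPrimitive, Finset.sum_mul, ← Finset.sum_sub_distrib, ← mul_sub]
  refine tendsto_finsetSum _ fun i _ => tendsto_finsetSum _ fun j _ => ?_
  rcases (hp i).eq_or_lt with h | h
  · simp [← h]
  · have h₁ : Tendsto (fun t : ℝ => q j / t + p i) atTop (𝓝 (p i)) := by
      simpa using (tendsto_const_nhds.div_atTop tendsto_id).add_const (p i)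
    have h₂ := ((h₁.log h.ne').sub_const (Real.log (q j))).const_mul (w i j * p i)
    refine h₂.congr' ?_
    filter_upwards [eventually_gt_atTop 0] with t ht
    have h₃ : q j + t * p i ≠ 0 := (add_pos_of_nonneg_of_pos (hq j) (mul_pos ht h)).ne'
    have h₄ : q j / t + p i = (q j + t * p i) / t := by field_simp
    rw [h₄, Real.log_div h₃ ht.ne']
    ring

open Filter in
theorem sum_mul_log_sub_log_le {w' : m → m → ℝ} {p' q' : m → ℝ} {w : n → n → ℝ} {p q : n → ℝ}
    (hp' : ∀ i, 0 ≤ p' i) (hq' : ∀ j, 0 ≤ q' j) (hw' : ∀ i j, q' j = 0 → w' i j * p' i = 0)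
    (hp : ∀ i, 0 ≤ p i) (hq : ∀ j, 0 ≤ q j) (hw : ∀ i j, q j = 0 → w i j * p i = 0)
    (htr : ∑ i, ∑ j, w' i j * p' i = ∑ i, ∑ j, w i j * p i)
    (hle : ∀ t : ℝ, 0 < t → ∑ i, ∑ j, w' i j * p' i ^ 2 / (q' j + t * p' i) ≤
      ∑ i, ∑ j, w i j * p i ^ 2 / (q j + t * p i)) :
    ∑ i, ∑ j, w' i j * p' i * (Real.log (p' i) - Real.log (q' j)) ≤
      ∑ i, ∑ j, w i j * p i * (Real.log (p i) - Real.log (q j)) := by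
  refine le_of_tendsto_of_tendsto (tendsto_relEntPrimitive_sub_log hp' hq')
    (tendsto_relEntPrimitive_sub_log hp hq) ?_
  filter_upwards [eventually_ge_atTop 0] with T hT
  rw [htr]
  refine sub_le_sub_right ?_ _
  have hmono : MonotoneOn (fun t => relEntPrimitive w p q t - relEntPrimitive w' p' q' t)
      (Set.Ici 0) := by
    refine monotoneOn_of_hasDerivWithinAt_nonneg (convex_Ici 0)
      ((continuousOn_relEntPrimitive hp hq hw).sub (continuousOn_relEntPrimitive hp' hq' hw'))
      (fun t ht => ((hasDerivAt_relEntPrimitive hp hq ?_).sub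
        (hasDerivAt_relEntPrimitive hp' hq' ?_)).hasDerivWithinAt)
      (fun t ht => sub_nonneg.2 (hle t ?_)) <;>
    simpa using ht
  have h := hmono (Set.mem_Ici.2 le_rfl) hT hT
  simp only [relEntPrimitive_zero, sub_zero] at h
  exact sub_nonneg.1 h

end Primitive

section Monotonicity

variable {m n : Type*} [Fintype m] [DecidableEq m] [Fintype n] [DecidableEq n]

theorem Matrix.IsHermitian.eq_conj_diagonal {A : Matrix n n ℂ} (h : A.IsHermitian) :
    A = (h.eigenvectorUnitary : Matrix n n ℂ) * diagonal (fun i => (h.eigenvalues i : ℂ)) *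
      (h.eigenvectorUnitary : Matrix n n ℂ)ᴴ :=
  h.spectral_theorem

/-- The squared overlaps of the eigenvectors of two Hermitian matrices. -/
def eigenOverlap {A B : Matrix n n ℂ} (hA : A.IsHermitian) (hB : B.IsHermitian) (i j : n) : ℝ :=
  Complex.normSq (((hB.eigenvectorUnitary : Matrix n n ℂ)ᴴ *
    (hA.eigenvectorUnitary : Matrix n n ℂ)) j i)

theorem relEnt_eq_sum {ρ σ : Matrix n n ℂ} (hρ : ρ.IsHermitian) (hσ : σ.IsHermitian) :
    relEnt hρ hσ = ∑ i, ∑ j, eigenOverlap hρ hσ i j * hρ.eigenvalues i *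
      (Real.log (hρ.eigenvalues i) - Real.log (hσ.eigenvalues j)) := by
  have h₁ : ρ * hermLog hρ =
      (hρ.eigenvectorUnitary : Matrix n n ℂ) *
        diagonal (fun i => ((hρ.eigenvalues i * Real.log (hρ.eigenvalues i) : ℝ) : ℂ)) *
        (hρ.eigenvectorUnitary : Matrix n n ℂ)ᴴ *
      ((hσ.eigenvectorUnitary : Matrix n n ℂ) * diagonal (fun _ => ((1 : ℝ) : ℂ)) *
        (hσ.eigenvectorUnitary : Matrix n n ℂ)ᴴ) := by
    have hU : (hσ.eigenvectorUnitary : Matrix n n ℂ) * (hσ.eigenvectorUnitary : Matrix n n ℂ)ᴴ = 1 :=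
      mem_unitaryGroup_iff.1 hσ.eigenvectorUnitary.2
    have hW : (hρ.eigenvectorUnitary : Matrix n n ℂ)ᴴ *
        (hρ.eigenvectorUnitary : Matrix n n ℂ) = 1 :=
      mem_unitaryGroup_iff'.1 hρ.eigenvectorUnitary.2
    refine (congrArg (· * hermLog hρ) hρ.eq_conj_diagonal).trans ?_
    simp only [Complex.ofReal_one, diagonal_one, Matrix.mul_one, hU, hermLog, star_eq_conjTranspose,
      Complex.ofReal_mul, ← diagonal_mul_diagonal]
    simp only [Matrix.mul_assoc]
    rw [← Matrix.mul_assoc _ (hρ.eigenvectorUnitary : Matrix n n ℂ), hW, Matrix.one_mul]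
  have h₂ : (ρ * hermLog hσ).trace.re = ∑ i, ∑ j, eigenOverlap hρ hσ i j *
      hρ.eigenvalues i * Real.log (hσ.eigenvalues j) := by
    conv_lhs => rw [hρ.eq_conj_diagonal]
    exact trace_conj_diagonal_mul_conj_diagonal _ _ _ _
  rw [relEnt, Matrix.mul_sub, trace_sub, Complex.sub_re, h₂, h₁,
    trace_conj_diagonal_mul_conj_diagonal]
  simp only [← Finset.sum_sub_distrib]
  refine Finset.sum_congr rfl fun i _ => Finset.sum_congr rfl fun j _ => ?_
  rw [eigenOverlap]
  ring

theorem sum_eigenOverlap_mul_eigenvalues {ρ σ : Matrix n n ℂ} (hρ : ρ.IsHermitian)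
    (hσ : σ.IsHermitian) :
    ∑ i, ∑ j, eigenOverlap hρ hσ i j * hρ.eigenvalues i = ρ.trace.re := by
  have hU : (hσ.eigenvectorUnitary : Matrix n n ℂ) * (hσ.eigenvectorUnitary : Matrix n n ℂ)ᴴ = 1 :=
    mem_unitaryGroup_iff.1 hσ.eigenvectorUnitary.2
  have h := trace_conj_diagonal_mul_conj_diagonal (hσ.eigenvectorUnitary : Matrix n n ℂ)
    (hρ.eigenvectorUnitary : Matrix n n ℂ) hρ.eigenvalues (fun _ => 1)
  rw [← hρ.eq_conj_diagonal] at h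
  simpa [hU, eigenOverlap] using h.symm

theorem eigenOverlap_mul_eigenvalues_eq_zero {ρ σ : Matrix n n ℂ} (hρ : ρ.IsHermitian)
    (hσ : σ.IsHermitian) (hker : ∀ X : Matrix n n ℂ, σ * X = 0 → ρ * X = 0) (i j : n)
    (hj : hσ.eigenvalues j = 0) : eigenOverlap hρ hσ i j * hρ.eigenvalues i = 0 := by
  set U := (hσ.eigenvectorUnitary : Matrix n n ℂ) with hUdef
  set W := (hρ.eigenvectorUnitary : Matrix n n ℂ) with hWdef
  have hU : Uᴴ * U = 1 := mem_unitaryGroup_iff'.1 hσ.eigenvectorUnitary.2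
  have hW : Wᴴ * W = 1 := mem_unitaryGroup_iff'.1 hρ.eigenvectorUnitary.2
  have h₁ : σ * (U * single j j 1) = 0 := by
    rw [hσ.eq_conj_diagonal, ← hUdef, Matrix.mul_assoc, ← Matrix.mul_assoc Uᴴ, hU, Matrix.one_mul,
      Matrix.mul_assoc]
    have : diagonal (fun i => (hσ.eigenvalues i : ℂ)) * single j j 1 = 0 := by
      ext a b
      by_cases ha : j = a <;> simp [diagonal_mul, single_apply, ha]
      simp [← ha, hj]
    rw [this, Matrix.mul_zero]
  have h₂ : diagonal (fun i => (hρ.eigenvalues i : ℂ)) * ((Wᴴ * U) * single j j 1) = 0 := by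
    have h := congrArg (Wᴴ * ·) (hker _ h₁)
    rw [hρ.eq_conj_diagonal, ← hWdef] at h
    simp only [Matrix.mul_zero, ← Matrix.mul_assoc, hW, Matrix.one_mul] at h
    simpa only [Matrix.mul_assoc] using h
  have h₃ := congrFun (congrFun h₂ i) j
  have h₄ : (Wᴴ * U) i j = star ((Uᴴ * W) j i) := by
    rw [← conjTranspose_apply, conjTranspose_mul, conjTranspose_conjTranspose]
  simp only [diagonal_mul, mul_single_apply_same, mul_one, h₄, Matrix.zero_apply, mul_eq_zero,
    Complex.ofReal_eq_zero, star_eq_zero] at h₃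
  rw [eigenOverlap, ← hUdef, ← hWdef]
  rcases h₃ with h | h <;> simp [h]

theorem isGreatest_relEntForm_eigenvalues {ρ σ : Matrix n n ℂ} (hρ : ρ.PosSemidef)
    (hσ : σ.PosSemidef) {t : ℝ} (ht : 0 < t) :
    IsGreatest (Set.range (relEntForm t ρ σ))
      (∑ i, ∑ j, eigenOverlap hρ.1 hσ.1 i j * hρ.1.eigenvalues i ^ 2 /
        (hσ.1.eigenvalues j + t * hρ.1.eigenvalues i)) := by
  have h := isGreatest_relEntForm hσ.1.eigenvectorUnitary.2 hρ.1.eigenvectorUnitary.2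
    hρ.eigenvalues_nonneg hσ.eigenvalues_nonneg ht
  rwa [← hρ.1.eq_conj_diagonal, ← hσ.1.eq_conj_diagonal] at h

theorem Matrix.PosSemidef.mul_eq_zero_of_trace {n : Type*} [Fintype n] {A : Matrix n n ℂ}
    (hA : A.PosSemidef)
    {X : Matrix n n ℂ} (h : (Xᴴ * A * X).trace = 0) : A * X = 0 := by
  have h₁ : ∀ b, A *ᵥ X.col b = 0 := fun b => by
    rw [← hA.dotProduct_mulVec_zero_iff]
    have h₂ : (Xᴴ * A * X).trace = ∑ b, star (X.col b) ⬝ᵥ A *ᵥ X.col b := by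
      rw [Matrix.mul_assoc]
      rfl
    exact (Finset.sum_eq_zero_iff_of_nonneg fun b _ => hA.dotProduct_mulVec_nonneg _).1
      (h₂.symm.trans h) b (Finset.mem_univ _)
  ext a b
  exact congrFun (h₁ b) a

theorem trace_conjTranspose_map_mul_map {Φ : Matrix m m ℂ →* Matrix n n ℂ}
    (hΦ : ∀ Y, Φ Yᴴ = (Φ Y)ᴴ) {A : Matrix n n ℂ} {A' : Matrix m m ℂ}
    (hA : ∀ Y, (Φ Y * A).trace = (Y * A').trace) (Y : Matrix m m ℂ) :
    ((Φ Y)ᴴ * A * Φ Y).trace = (Yᴴ * A' * Y).trace := by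
  rw [trace_mul_comm, ← Matrix.mul_assoc, ← hΦ, ← map_mul, hA, trace_mul_comm (Yᴴ * A'),
    Matrix.mul_assoc]

theorem trace_map_mul_conjTranspose_map {Φ : Matrix m m ℂ →* Matrix n n ℂ}
    (hΦ : ∀ Y, Φ Yᴴ = (Φ Y)ᴴ) {A : Matrix n n ℂ} {A' : Matrix m m ℂ}
    (hA : ∀ Y, (Φ Y * A).trace = (Y * A').trace) (Y : Matrix m m ℂ) :
    (Φ Y * A * (Φ Y)ᴴ).trace = (Y * A' * Yᴴ).trace := by
  simpa [hΦ] using trace_conjTranspose_map_mul_map hΦ hA Yᴴ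

/-- Monotonicity of the relative entropy under the trace-dual `ρ ↦ ρ'` of a unital
star-preserving multiplicative map `Φ`. -/
theorem relEnt_le_of_trace_dual {Φ : Matrix m m ℂ →* Matrix n n ℂ}
    (hΦ : ∀ Y, Φ Yᴴ = (Φ Y)ᴴ) {ρ σ : Matrix n n ℂ} {ρ' σ' : Matrix m m ℂ}
    (hρ : ρ.PosSemidef) (hσ : σ.PosSemidef) (hρ' : ρ'.PosSemidef) (hσ' : σ'.PosSemidef)
    (hker : ∀ v : n → ℂ, σ *ᵥ v = 0 → ρ *ᵥ v = 0)
    (hρΦ : ∀ Y, (Φ Y * ρ).trace = (Y * ρ').trace)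
    (hσΦ : ∀ Y, (Φ Y * σ).trace = (Y * σ').trace) :
    relEnt hρ'.1 hσ'.1 ≤ relEnt hρ.1 hσ.1 := by
  have hkerM : ∀ X : Matrix n n ℂ, σ * X = 0 → ρ * X = 0 := fun X hX => by
    ext a b
    exact congrFun (hker (fun i => X i b) (funext fun i => congrFun (congrFun hX i) b)) a
  have hkerM' : ∀ Y : Matrix m m ℂ, σ' * Y = 0 → ρ' * Y = 0 := fun Y hY => by
    have h₁ : σ * Φ Y = 0 := hσ.mul_eq_zero_of_trace <| by
      rw [trace_conjTranspose_map_mul_map hΦ hσΦ, Matrix.mul_assoc, hY, Matrix.mul_zero, trace_zero]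
    refine hρ'.mul_eq_zero_of_trace ?_
    rw [← trace_conjTranspose_map_mul_map hΦ hρΦ, Matrix.mul_assoc, hkerM _ h₁, Matrix.mul_zero,
      trace_zero]
  rw [relEnt_eq_sum, relEnt_eq_sum]
  refine sum_mul_log_sub_log_le hρ'.eigenvalues_nonneg hσ'.eigenvalues_nonneg
    (eigenOverlap_mul_eigenvalues_eq_zero hρ'.1 hσ'.1 hkerM') hρ.eigenvalues_nonneg
    hσ.eigenvalues_nonneg (eigenOverlap_mul_eigenvalues_eq_zero hρ.1 hσ.1 hkerM) ?_ ?_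
  · rw [sum_eigenOverlap_mul_eigenvalues, sum_eigenOverlap_mul_eigenvalues]
    simpa using congrArg Complex.re (hρΦ 1).symm
  · intro t ht
    obtain ⟨Y, hY⟩ := (isGreatest_relEntForm_eigenvalues hρ' hσ' ht).1
    rw [← hY]
    refine (isGreatest_relEntForm_eigenvalues hρ hσ ht).2 ⟨Φ Y, ?_⟩
    rw [relEntForm, relEntForm, ← hΦ, hρΦ, hΦ, trace_conjTranspose_map_mul_map hΦ hσΦ,
      trace_map_mul_conjTranspose_map hΦ hρΦ]

end Monotonicity

section PartialTrace

open scoped Kronecker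

variable {β γ δ : Type*}

theorem ptrB_posSemidef [Fintype δ] {ρ : Matrix (β × δ) (β × δ) ℂ} (hρ : ρ.PosSemidef) :
    (ptrB ρ).PosSemidef := by
  have h : ptrB ρ = ∑ d, ρ.submatrix (·, d) (·, d) := by
    ext a b
    simp [ptrB, Matrix.sum_apply]
  rw [h]
  exact posSemidef_sum _ fun d _ => hρ.submatrix _

theorem ptr1_posSemidef [Fintype β] {τ : Matrix (β × γ × δ) (β × γ × δ) ℂ} (hτ : τ.PosSemidef) :
    (ptr1 τ).PosSemidef := by
  have h : ptr1 τ = ∑ b, τ.submatrix (b, ·) (b, ·) := by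
    ext a c
    simp [ptr1, Matrix.sum_apply]
  rw [h]
  exact posSemidef_sum _ fun d _ => hτ.submatrix _

theorem ptr3_eq_ptrB [Fintype δ] (τ : Matrix (β × γ × δ) (β × γ × δ) ℂ) :
    ptr3 τ = ptrB (τ.submatrix (Equiv.prodAssoc β γ δ) (Equiv.prodAssoc β γ δ)) := rfl

theorem ptr3_posSemidef [Fintype δ] {τ : Matrix (β × γ × δ) (β × γ × δ) ℂ} (hτ : τ.PosSemidef) :
    (ptr3 τ).PosSemidef := by
  rw [ptr3_eq_ptrB]
  exact ptrB_posSemidef (hτ.submatrix _)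

theorem tens_one_posSemidef [Fintype β] [Fintype γ] [DecidableEq β]
    {A : Matrix γ γ ℂ} (hA : A.PosSemidef) :
    (tens (1 : Matrix β β ℂ) A).PosSemidef :=
  PosSemidef.one.kronecker hA

theorem ptr3_tens_one_ptr1 [Fintype β] [Fintype δ] [DecidableEq β]
    (τ : Matrix (β × γ × δ) (β × γ × δ) ℂ) :
    ptr3 (tens (1 : Matrix β β ℂ) (ptr1 τ)) = tens (1 : Matrix β β ℂ) (ptrA (ptr3 τ)) := by
  ext a b
  simp only [ptr3, ptr1, ptrA, tens]
  rw [Finset.sum_comm]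
  exact (Finset.mul_sum Finset.univ (fun d => ∑ x, τ (x, a.2, d) (x, b.2, d))
    ((1 : Matrix β β ℂ) a.1 b.1)).symm

theorem mulVec_eq_zero_of_tens_one_ptr1 [Fintype β] [Fintype γ] [Fintype δ] [DecidableEq β]
    {τ : Matrix (β × γ × δ) (β × γ × δ) ℂ}
    (hτ : τ.PosSemidef) (v : β × γ × δ → ℂ)
    (hv : tens (1 : Matrix β β ℂ) (ptr1 τ) *ᵥ v = 0) : τ *ᵥ v = 0 := by
  have h₁ : ∀ b, ptr1 τ *ᵥ (fun x => v (b, x)) = 0 := fun b => by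
    ext x
    have h := congrFun hv (b, x)
    simpa [mulVec, dotProduct, tens, one_apply, Fintype.sum_prod_type (α₁ := β)] using h
  let u : β → β → β × γ × δ → ℂ := fun b b' p => if p.1 = b' then v (b, p.2) else 0
  have h₂ : ∀ b, ∑ b', star (u b b') ⬝ᵥ (τ *ᵥ u b b') = 0 := fun b => by
    have h : star (fun x => v (b, x)) ⬝ᵥ (ptr1 τ *ᵥ (fun x => v (b, x))) = 0 := by
      rw [h₁ b, dotProduct_zero]
    rw [← h]
    simp only [u, dotProduct, mulVec, ptr1, Fintype.sum_prod_type (α₁ := β), Pi.star_apply,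
      apply_ite star, star_zero, ite_mul, zero_mul, mul_ite, mul_zero, Finset.sum_ite_irrel,
      Finset.sum_const_zero, Finset.sum_ite_eq', Finset.mem_univ, if_true]
    rw [Finset.sum_comm]
    refine Finset.sum_congr rfl fun x _ => ?_
    rw [← Finset.mul_sum, Finset.sum_comm]
    simp only [Finset.sum_mul]
  have h₃ : ∀ b b', τ *ᵥ u b b' = 0 := fun b b' => by
    rw [← hτ.dotProduct_mulVec_zero_iff]
    exact (Finset.sum_eq_zero_iff_of_nonneg fun b' _ => hτ.dotProduct_mulVec_nonneg _).1
      (h₂ b) b' (Finset.mem_univ _)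
  have h₄ : v = ∑ b, u b b := by
    ext p
    simp [u]
  rw [h₄, mulVec_sum]
  exact Finset.sum_eq_zero fun b _ => h₃ b b

variable [Fintype β] [Fintype γ] [Fintype δ] [DecidableEq β] [DecidableEq γ] [DecidableEq δ]

/-- The ampliation `Y ↦ Y ⊗ 1`. -/
def ampliation (β δ : Type*) [Fintype β] [Fintype δ] [DecidableEq β] [DecidableEq δ] :
    Matrix β β ℂ →* Matrix (β × δ) (β × δ) ℂ where
  toFun Y := Y ⊗ₖ 1
  map_one' := one_kronecker_one
  map_mul' X Y := by rw [← mul_kronecker_mul, Matrix.one_mul]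

theorem ampliation_conjTranspose (Y : Matrix β β ℂ) :
    ampliation β δ Yᴴ = (ampliation β δ Y)ᴴ := by
  simp [ampliation, conjTranspose_kronecker]

theorem trace_ampliation_mul (ρ : Matrix (β × δ) (β × δ) ℂ) (Y : Matrix β β ℂ) :
    (ampliation β δ Y * ρ).trace = (Y * ptrB ρ).trace := by
  simp only [ampliation, MonoidHom.coe_mk, OneHom.coe_mk, trace, diag_apply, mul_apply,
    kroneckerMap_apply, one_apply, ptrB, Fintype.sum_prod_type, Finset.mul_sum]
  simp only [mul_ite, mul_one, mul_zero, ite_mul, zero_mul, Finset.sum_ite_eq, Finset.mem_univ,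
    if_true]
  exact Finset.sum_congr rfl fun _ _ => Finset.sum_comm

/-- The ampliation `Y ↦ Y ⊗ 1` on the product bracketed to the right. -/
def ampliationAssoc (β γ δ : Type*) [Fintype β] [Fintype γ] [Fintype δ] [DecidableEq β]
    [DecidableEq γ] [DecidableEq δ] :
    Matrix (β × γ) (β × γ) ℂ →* Matrix (β × γ × δ) (β × γ × δ) ℂ :=
  (reindexAlgEquiv ℂ ℂ (Equiv.prodAssoc β γ δ) : _ →* _).comp (ampliation (β × γ) δ)

theorem ampliationAssoc_conjTranspose (Y : Matrix (β × γ) (β × γ) ℂ) :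
    ampliationAssoc β γ δ Yᴴ = (ampliationAssoc β γ δ Y)ᴴ := by
  simp [ampliationAssoc, ampliation_conjTranspose]

theorem trace_ampliationAssoc_mul (τ : Matrix (β × γ × δ) (β × γ × δ) ℂ)
    (Y : Matrix (β × γ) (β × γ) ℂ) :
    (ampliationAssoc β γ δ Y * τ).trace = (Y * ptr3 τ).trace := by
  rw [ptr3_eq_ptrB, ← trace_ampliation_mul]
  simp only [trace, diag_apply, mul_apply]
  simp only [← (Equiv.prodAssoc β γ δ).sum_comp]
  rfl

end PartialTrace

/-- monotonicity of quantum relative entropy under the partial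
trace (for supp ρ ⊆ supp σ); in particular, for any extension ρ_BCD of ρ_BC,
D(ρ_BC ‖ I_B ⊗ ρ_C) ≤ D(ρ_BCD ‖ I_B ⊗ ρ_CD). -/
theorem relEnt_monotone {β γ δ : Type*}
    [Fintype β] [Fintype γ] [Fintype δ]
    [DecidableEq β] [DecidableEq γ] [DecidableEq δ]
    (ρ σ : Matrix (β × δ) (β × δ) ℂ)
    (hρ : IsDensity ρ) (hσ : IsDensity σ)
    (hsupp : ∀ v : (β × δ) → ℂ, σ *ᵥ v = 0 → ρ *ᵥ v = 0)
    (hρ' : (ptrB ρ).IsHermitian) (hσ' : (ptrB σ).IsHermitian)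
    (τ : Matrix (β × γ × δ) (β × γ × δ) ℂ) (hτ : IsDensity τ)
    (h₁ : (ptr3 τ).IsHermitian)
    (h₂ : (tens (1 : Matrix β β ℂ) (ptrA (ptr3 τ))).IsHermitian)
    (h₃ : (tens (1 : Matrix β β ℂ) (ptr1 τ)).IsHermitian) :
    relEnt hρ' hσ' ≤ relEnt hρ.1.1 hσ.1.1 ∧
    relEnt h₁ h₂ ≤ relEnt hτ.1.1 h₃ := by
  refine ⟨relEnt_le_of_trace_dual ampliation_conjTranspose hρ.1 hσ.1 (ptrB_posSemidef hρ.1)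
    (ptrB_posSemidef hσ.1) hsupp (trace_ampliation_mul ρ) (trace_ampliation_mul σ), ?_⟩
  have h : (tens (1 : Matrix β β ℂ) (ptr1 τ)).PosSemidef :=
    tens_one_posSemidef (ptr1_posSemidef hτ.1)
  have h₁' : (ptr3 τ).PosSemidef := ptr3_posSemidef hτ.1
  have h₂' : (tens (1 : Matrix β β ℂ) (ptrA (ptr3 τ))).PosSemidef := by
    rw [← ptr3_tens_one_ptr1]
    exact ptr3_posSemidef h
  refine relEnt_le_of_trace_dual ampliationAssoc_conjTranspose hτ.1 h h₁' h₂'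
    (mulVec_eq_zero_of_tens_one_ptr1 hτ.1) (trace_ampliationAssoc_mul τ) fun Y => ?_
  rw [trace_ampliationAssoc_mul, ptr3_tens_one_ptr1]

end
end
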